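/- Let m ≥ 1, n ≥ 2, s ≥ 2, let μ be a phase-symmetric probability measure on ℂ^m (coordinates indexed by ZMod m), and let x_1, …, x_M ∈ ℂ^n be s-sparse plaintexts with M · s·(s−1) < n·(n−1). Then there exist complex m×n matrices Q and Q' such that Q ≠ θ·Q' for every θ ∈ ℂ with |θ| = 1, and yet for every k ∈ {1, …, M} the pushforward of μ under h ↦ h ⊛ (Q x_k) equals the pushforward of μ under h ↦ h ⊛ (Q' x_k). In other words, fewer than n(n−1)/(s(s−1)) s-sparse plaintexts cannot retrieve the key for any phase-symmetric filter distribution. -/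

import Mathlib

open MeasureTheory Complex

/-- Circular convolution on ℂ^m: (h ⊛ v)(i) = ∑ⱼ h(j) · v(i − j). -/
noncomputable def cconv {m : ℕ} [NeZero m] (h v : ZMod m → ℂ) : ZMod m → ℂ :=
  fun i => ∑ j : ZMod m, h j * v (i - j)

/-- A measure on ℂ^m is phase-symmetric if it is invariant under multiplication
by any global unit scalar. -/
def PhaseSymmetric {m : ℕ} (μ : Measure (ZMod m → ℂ)) : Prop :=
  ∀ θ : ℂ, ‖θ‖ = 1 → μ.map (fun h => θ • h) = μ

/-- A vector x ∈ ℂ^n is s-sparse if its support has at most s elements. -/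
def IsSparse {n : ℕ} (s : ℕ) (x : Fin n → ℂ) : Prop :=
  Set.ncard {i | x i ≠ 0} ≤ s

theorem measurable_cconv_left {m : ℕ} [NeZero m] (v : ZMod m → ℂ) :
    Measurable (fun h : ZMod m → ℂ => cconv h v) := by
  unfold cconv
  fun_prop

theorem PhaseSymmetric.map_cconv_neg {m : ℕ} [NeZero m] {μ : Measure (ZMod m → ℂ)}
    (hμ : PhaseSymmetric μ) (v : ZMod m → ℂ) :
    μ.map (fun h => cconv h (-v)) = μ.map (fun h => cconv h v) := by
  conv_rhs => rw [← hμ (-1) (by simp)]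
  rw [Measure.map_map (measurable_cconv_left v) (by fun_prop)]
  congr 1
  funext h i
  simp [cconv]

/-- A family of `M` sets of size at most `s` with `M * (s * (s - 1)) < n * (n - 1)` fails to
cover some pair of distinct points. -/
theorem exists_ne_forall_notMem_or_notMem {ι κ : Type*} [Fintype ι] [Fintype κ] [DecidableEq κ]
    {s : ℕ} (S : ι → Finset κ) (hS : ∀ k, (S k).card ≤ s)
    (h : Fintype.card ι * (s * (s - 1)) < Fintype.card κ * (Fintype.card κ - 1)) :
    ∃ a b : κ, a ≠ b ∧ ∀ k, a ∉ S k ∨ b ∉ S k := by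
  by_contra! hcover
  have hsub : (Finset.univ : Finset κ).offDiag ⊆ Finset.univ.biUnion fun k => (S k).offDiag := by
    rintro ⟨a, b⟩ hab
    obtain ⟨k, hk⟩ := hcover a b (by simpa using hab)
    simp only [Finset.mem_biUnion, Finset.mem_offDiag]
    exact ⟨k, Finset.mem_univ k, hk.1, hk.2, by simpa using hab⟩
  have hle := (Finset.card_le_card hsub).trans
    (Finset.card_biUnion_le_card_mul _ _ (s * (s - 1)) fun k _ => by
      rw [Finset.offDiag_card, ← Nat.mul_sub_one]
      exact Nat.mul_le_mul (hS k) (Nat.sub_le_sub_right (hS k) 1))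
  rw [Finset.offDiag_card, ← Nat.mul_sub_one, Finset.card_univ, Finset.card_univ] at hle
  exact absurd h hle.not_gt

/-- Fewer than n(n−1)/(s(s−1)) s-sparse plaintexts cannot retrieve the key for any
phase-symmetric filter distribution. -/
theorem sparse_no_key_retrieval (m n M s : ℕ) [NeZero m] (hm : 1 ≤ m) (hn : 2 ≤ n)
    (hs : 2 ≤ s)
    (μ : Measure (ZMod m → ℂ)) [IsProbabilityMeasure μ] (hμ : PhaseSymmetric μ)
    (x : Fin M → Fin n → ℂ) (hx : ∀ k, IsSparse s (x k))
    (hM : M * (s * (s - 1)) < n * (n - 1)) :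
    ∃ Q Q' : Matrix (ZMod m) (Fin n) ℂ,
      (∀ θ : ℂ, ‖θ‖ = 1 → Q ≠ θ • Q') ∧
      ∀ k : Fin M,
        μ.map (fun h => cconv h (Q.mulVec (x k))) =
        μ.map (fun h => cconv h (Q'.mulVec (x k))) := by
  obtain ⟨a, b, hab, hcov⟩ := exists_ne_forall_notMem_or_notMem
    (fun k => Finset.univ.filter fun i => x k i ≠ 0)
    (fun k => by simpa [IsSparse, Set.ncard_eq_toFinset_card'] using hx k) (by simpa using hM)
  refine ⟨.of fun _ => Pi.single a 1 + Pi.single b 1, .of fun _ => Pi.single a 1 - Pi.single b 1,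
    fun θ _ h => ?_, fun k => ?_⟩
  · have ha : 1 = θ := by simpa [hab] using congrFun (congrFun h 0) a
    have hb : 1 = -θ := by simpa [hab.symm] using congrFun (congrFun h 0) b
    rw [← ha] at hb
    norm_num at hb
  · have hQ : (Matrix.of fun _ : ZMod m =>
        (Pi.single a 1 + Pi.single b 1 : Fin n → ℂ)).mulVec (x k) = fun _ => x k a + x k b := by
      funext i
      change (Pi.single a 1 + Pi.single b 1) ⬝ᵥ x k = _
      simp [add_dotProduct]
    have hQ' : (Matrix.of fun _ : ZMod m =>
        (Pi.single a 1 - Pi.single b 1 : Fin n → ℂ)).mulVec (x k) = fun _ => x k a - x k b := by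
      funext i
      change (Pi.single a 1 - Pi.single b 1) ⬝ᵥ x k = _
      simp [sub_dotProduct]
    rw [hQ, hQ']
    rcases hcov k with h | h
    · have h0 : x k a = 0 := by simpa using h
      rw [← hμ.map_cconv_neg fun _ => x k a - x k b]
      simp [h0, Pi.neg_def]
    · have h0 : x k b = 0 := by simpa using h
      simp [h0]
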